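/- Let X_1,…,X_N be jointly distributed random variables with values in a finite type V, let 1 ≤ i ≤ n < N, let f_i : V^i → W_i be any function into a finite type, and let f_n : V^n → W_n be a function into a finite type that is contextual for position n, i.e. for any two prefixes x, x' ∈ V^n each having positive probability, f_n(x) = f_n(x') implies that the conditional distributions of X_{n+1} given X_{≤n} = x and given X_{≤n} = x' are equal. If I(X_{≤n}; X_{n+1}) > 0, then I(f_n(X_{≤n}); X_{n+1}) = I(X_{≤n}; X_{n+1}) > 0 and I(X_{≤i}; X_{n+1}) / I(X_{≤n}; X_{n+1}) ≥ I(f_i(X_{≤i}); X_{n+1}) / I(f_n(X_{≤n}); X_{n+1}). -/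

import Mathlib

open Finset

/-- Shannon entropy of a pmf `q` on a finite type, `H(q) = -∑ s, q s * log (q s)`
(with the convention `0 * log 0 = 0`, which holds since `Real.log 0 = 0`). -/
noncomputable def shannonEntropy {S : Type*} [Fintype S] (q : S → ℝ) : ℝ :=
  -∑ s, q s * Real.log (q s)

/-- Marginal probability `P(X = a)` for a random variable `X` on a finite sample
space with joint pmf `p`. -/
noncomputable def probOf {Ω A : Type*} [Fintype Ω] [DecidableEq A]
    (p : Ω → ℝ) (X : Ω → A) (a : A) : ℝ :=
  ∑ ω, if X ω = a then p ω else 0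

/-- Conditional pmf of `Y` given `X = a`: `b ↦ P(X = a, Y = b) / P(X = a)`. -/
noncomputable def condDist {Ω A B : Type*} [Fintype Ω] [DecidableEq A] [DecidableEq B]
    (p : Ω → ℝ) (X : Ω → A) (Y : Ω → B) (a : A) : B → ℝ :=
  fun b => (∑ ω, if X ω = a ∧ Y ω = b then p ω else 0) / probOf p X a

/-- Conditional entropy `H(Y | X) = ∑_{a : P(X=a) > 0} P(X = a) · H(Y | X = a)`.
(Terms with `P(X = a) = 0` contribute `0` to the sum, so we may sum over all `a`.) -/
noncomputable def condEnt {Ω A B : Type*} [Fintype Ω] [Fintype A] [Fintype B]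
    [DecidableEq A] [DecidableEq B] (p : Ω → ℝ) (X : Ω → A) (Y : Ω → B) : ℝ :=
  ∑ a, probOf p X a * shannonEntropy (condDist p X Y a)

/-- Mutual information `I(X;Y) = H(Y) - H(Y|X)`. -/
noncomputable def mutInfo {Ω A B : Type*} [Fintype Ω] [Fintype A] [Fintype B]
    [DecidableEq A] [DecidableEq B] (p : Ω → ℝ) (X : Ω → A) (Y : Ω → B) : ℝ :=
  shannonEntropy (fun b => probOf p Y b) - condEnt p X Y

/-- The prefix `X_{≤i} = (X_1, …, X_i)` of the process `X_1, …, X_N`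
(0-based: `X_k` is coordinate `k - 1`). -/
def prefixVar {N : ℕ} {V : Type*} (i : ℕ) (h : i ≤ N) : (Fin N → V) → Fin i → V :=
  fun ω k => ω (Fin.castLE h k)

theorem shannonEntropy_eq_sum_negMulLog {S : Type*} [Fintype S] (q : S → ℝ) :
    shannonEntropy q = ∑ s, Real.negMulLog (q s) := by
  simp [shannonEntropy, Real.negMulLog]

theorem sum_mul_negMulLog_le {ι : Type*} (s : Finset ι) (w x : ι → ℝ)
    (hw : ∀ a ∈ s, 0 ≤ w a) (hx : ∀ a ∈ s, 0 ≤ x a) :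
    ∑ a ∈ s, w a * Real.negMulLog (x a)
      ≤ (∑ a ∈ s, w a) * Real.negMulLog ((∑ a ∈ s, w a * x a) / ∑ a ∈ s, w a) := by
  rcases (Finset.sum_nonneg hw).eq_or_lt with h | h
  · rw [← h, zero_mul]
    refine (Finset.sum_eq_zero fun a ha => ?_).le
    rw [(Finset.sum_eq_zero_iff_of_nonneg hw).1 h.symm a ha, zero_mul]
  · have key := Real.concaveOn_negMulLog.le_map_centerMass hw h hx
    simp only [Finset.centerMass, smul_eq_mul, inv_mul_eq_div] at key
    rwa [div_le_iff₀' h] at key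

section Coarsening

variable {Ω A B C : Type*} [Fintype Ω] [DecidableEq A] [DecidableEq B]
  [DecidableEq C] {p : Ω → ℝ}

theorem probOf_nonneg (hp : ∀ ω, 0 ≤ p ω) (X : Ω → A) (a : A) : 0 ≤ probOf p X a :=
  Finset.sum_nonneg fun ω _ => by split_ifs <;> simp [hp]

theorem condDist_nonneg (hp : ∀ ω, 0 ≤ p ω) (X : Ω → A) (Y : Ω → B) (a : A) (b : B) :
    0 ≤ condDist p X Y a b :=
  div_nonneg (Finset.sum_nonneg fun ω _ => by split_ifs <;> simp [hp]) (probOf_nonneg hp X a)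

/-- The chain rule `P(X = a) * P(Y = b | X = a) = P(X = a, Y = b)`, valid also when
`P(X = a) = 0`. -/
theorem probOf_mul_condDist (hp : ∀ ω, 0 ≤ p ω) (X : Ω → A) (Y : Ω → B) (a : A) (b : B) :
    probOf p X a * condDist p X Y a b = ∑ ω, if X ω = a ∧ Y ω = b then p ω else 0 := by
  refine mul_div_cancel_of_imp' fun h => ?_
  have hz := (Finset.sum_eq_zero_iff_of_nonneg fun ω _ => by split_ifs <;> simp [hp]).1 h
  refine Finset.sum_eq_zero fun ω hω => ?_
  have := hz ω hω
  by_cases hX : X ω = a <;> simp_all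

variable [Fintype A]

theorem probOf_comp (f : A → C) (X : Ω → A) (c : C) :
    probOf p (fun ω => f (X ω)) c = ∑ a with f a = c, probOf p X a := by
  simp only [probOf]
  rw [Finset.sum_comm]
  simp [Finset.sum_ite_eq]

theorem probOf_comp_mul_condDist (hp : ∀ ω, 0 ≤ p ω) (f : A → C) (X : Ω → A) (Y : Ω → B)
    (c : C) (b : B) :
    probOf p (fun ω => f (X ω)) c * condDist p (fun ω => f (X ω)) Y c b
      = ∑ a with f a = c, probOf p X a * condDist p X Y a b := by
  simp only [probOf_mul_condDist hp]
  rw [Finset.sum_comm]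
  simp [ite_and, Finset.sum_ite_eq]

variable [Fintype B] [Fintype C]

theorem condEnt_eq_sum_fiber (f : A → C) (X : Ω → A) (Y : Ω → B) :
    condEnt p X Y
      = ∑ c, ∑ a with f a = c, probOf p X a * shannonEntropy (condDist p X Y a) :=
  (Finset.sum_fiberwise _ _ _).symm

/-- Conditioning on a function of `X` leaves at least as much entropy as conditioning on `X`. -/
theorem condEnt_le_condEnt_comp (hp : ∀ ω, 0 ≤ p ω) (f : A → C) (X : Ω → A) (Y : Ω → B) :
    condEnt p X Y ≤ condEnt p (fun ω => f (X ω)) Y := by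
  rw [condEnt_eq_sum_fiber f]
  refine Finset.sum_le_sum fun c _ => ?_
  simp only [shannonEntropy_eq_sum_negMulLog, Finset.mul_sum]
  rw [Finset.sum_comm]
  refine Finset.sum_le_sum fun b _ => ?_
  refine (sum_mul_negMulLog_le _ _ _ (fun a _ => probOf_nonneg hp X a)
    (fun a _ => condDist_nonneg hp X Y a b)).trans_eq ?_
  rw [← probOf_comp, ← probOf_comp_mul_condDist hp]
  by_cases h : probOf p (fun ω => f (X ω)) c = 0
  · simp [h]
  · rw [mul_div_cancel_left₀ _ h]

/-- The data processing inequality. -/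
theorem mutInfo_comp_le (hp : ∀ ω, 0 ≤ p ω) (f : A → C) (X : Ω → A) (Y : Ω → B) :
    mutInfo p (fun ω => f (X ω)) Y ≤ mutInfo p X Y :=
  sub_le_sub_left (condEnt_le_condEnt_comp hp f X Y) _

/-- Mutual information is preserved by a statistic which determines the conditional
distribution of `Y`. -/
theorem mutInfo_comp_eq (hp : ∀ ω, 0 ≤ p ω) (f : A → C) (X : Ω → A) (Y : Ω → B)
    (hf : ∀ x x', 0 < probOf p X x → 0 < probOf p X x' → f x = f x' →
      condDist p X Y x = condDist p X Y x') :
    mutInfo p (fun ω => f (X ω)) Y = mutInfo p X Y := by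
  refine congrArg (shannonEntropy (probOf p Y) - ·) ?_
  rw [condEnt_eq_sum_fiber f]
  refine Finset.sum_congr rfl fun c _ => ?_
  have hnn : ∀ a ∈ Finset.univ.filter (f · = c), 0 ≤ probOf p X a :=
    fun a _ => probOf_nonneg hp X a
  rcases (probOf_nonneg hp (fun ω => f (X ω)) c).eq_or_lt with h | h
  · rw [← h, zero_mul]
    rw [probOf_comp, eq_comm, Finset.sum_eq_zero_iff_of_nonneg hnn] at h
    exact (Finset.sum_eq_zero fun a ha => by rw [h a ha, zero_mul]).symm
  · obtain ⟨a₀, ha₀, hpos⟩ : ∃ a ∈ Finset.univ.filter (f · = c), 0 < probOf p X a := by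
      rw [probOf_comp] at h
      exact (Finset.sum_pos_iff_of_nonneg hnn).1 h
    have hconst (F : (B → ℝ) → ℝ) :
        ∑ a with f a = c, probOf p X a * F (condDist p X Y a)
          = probOf p (fun ω => f (X ω)) c * F (condDist p X Y a₀) := by
      rw [probOf_comp, Finset.sum_mul]
      refine Finset.sum_congr rfl fun a ha => ?_
      rcases (probOf_nonneg hp X a).eq_or_lt with h0 | h0
      · simp [← h0]
      · rw [hf a a₀ h0 hpos (by simp_all)]
    have hcond : condDist p (fun ω => f (X ω)) Y c = condDist p X Y a₀ := by
      ext b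
      refine mul_left_cancel₀ h.ne' ?_
      rw [probOf_comp_mul_condDist hp]
      exact hconst fun q => q b
    rw [hcond]
    exact (hconst shannonEntropy).symm

end Coarsening

/-- If `f_n` is contextual for position `n` and `I(X_{≤n}; X_{n+1}) > 0`,
then `I(f_n(X_{≤n}); X_{n+1}) = I(X_{≤n}; X_{n+1}) > 0` and
`I(X_{≤i}; X_{n+1}) / I(X_{≤n}; X_{n+1}) ≥ I(f_i(X_{≤i}); X_{n+1}) / I(f_n(X_{≤n}); X_{n+1})`. -/
theorem mutInfo_ratio_ge {N : ℕ} {V Wi Wn : Type*} [Fintype V] [DecidableEq V]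
    [Fintype Wi] [DecidableEq Wi] [Fintype Wn] [DecidableEq Wn]
    (p : (Fin N → V) → ℝ) (hp0 : ∀ x, 0 ≤ p x) (hp1 : ∑ x, p x = 1)
    (i n : ℕ) (hi : 1 ≤ i) (hin : i ≤ n) (hn : n < N)
    (fi : (Fin i → V) → Wi) (fn : (Fin n → V) → Wn)
    (hfn : ∀ x x' : Fin n → V,
      0 < probOf p (prefixVar n hn.le) x →
      0 < probOf p (prefixVar n hn.le) x' →
      fn x = fn x' →
      condDist p (prefixVar n hn.le) (fun ω => ω ⟨n, hn⟩) x
        = condDist p (prefixVar n hn.le) (fun ω => ω ⟨n, hn⟩) x')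
    (hpos : 0 < mutInfo p (prefixVar n hn.le) (fun ω => ω ⟨n, hn⟩)) :
    (mutInfo p (fun ω => fn (prefixVar n hn.le ω)) (fun ω => ω ⟨n, hn⟩)
        = mutInfo p (prefixVar n hn.le) (fun ω => ω ⟨n, hn⟩)) ∧
    (0 < mutInfo p (fun ω => fn (prefixVar n hn.le ω)) (fun ω => ω ⟨n, hn⟩)) ∧
    (mutInfo p (prefixVar i (by omega)) (fun ω => ω ⟨n, hn⟩)
        / mutInfo p (prefixVar n hn.le) (fun ω => ω ⟨n, hn⟩)
      ≥ mutInfo p (fun ω => fi (prefixVar i (by omega) ω)) (fun ω => ω ⟨n, hn⟩)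
        / mutInfo p (fun ω => fn (prefixVar n hn.le ω)) (fun ω => ω ⟨n, hn⟩)) := by
  have heq := mutInfo_comp_eq hp0 fn (prefixVar n hn.le) (fun ω => ω ⟨n, hn⟩) hfn
  refine ⟨heq, heq ▸ hpos, ?_⟩
  rw [heq]
  exact div_le_div_of_nonneg_right (mutInfo_comp_le hp0 fi _ _) hpos.le
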